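/- Let n, m ≥ 1, α ∈ (0,1), β ≥ 0, and set Q = (n + m(β+1−α))/(1−α). For every p with 1 ≤ p < Q there exists a constant C_p > 0 such that for every f ∈ C_c^∞(ℝ^{n+m}), (∫_{ℝ^{n+m}} |f(ξ)|^{Qp/(Q−p)} dξ)^{(Q−p)/Q} ≤ C_p ∫_{ℝ^{n+m}} |∇_L f(ξ)|^p dξ. -/

import Mathlib

open MeasureTheory

/-- The pointwise norm of the Grushin gradient
`∇_L f = (|x|^α ∇_x f, |x|^β ∇_y f)` of `f : ℝⁿ × ℝᵐ → ℝ`,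
i.e. `|∇_L f(x,y)|² = |x|^{2α} |∇_x f|² + |x|^{2β} |∇_y f|²`. -/
noncomputable def gradLNorm (n m : ℕ) (α β : ℝ)
    (f : EuclideanSpace ℝ (Fin n) × EuclideanSpace ℝ (Fin m) → ℝ)
    (ξ : EuclideanSpace ℝ (Fin n) × EuclideanSpace ℝ (Fin m)) : ℝ :=
  Real.sqrt (‖ξ.1‖ ^ (2 * α) * ‖gradient (fun x => f (x, ξ.2)) ξ.1‖ ^ 2
    + ‖ξ.1‖ ^ (2 * β) * ‖gradient (fun y => f (ξ.1, y)) ξ.2‖ ^ 2)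

/-- The homogeneous dimension `Q = (n + m(β+1−α))/(1−α)`. -/
noncomputable def homDim (n m : ℕ) (α β : ℝ) : ℝ :=
  (n + m * (β + 1 - α)) / (1 - α)

open scoped ENNReal

theorem HasCompactSupport.enorm_le_setLIntegral_Ici_deriv {u : ℝ → ℝ} (hu : ContDiff ℝ 1 u)
    (h2u : HasCompactSupport u) (b : ℝ) : ‖u b‖ₑ ≤ ∫⁻ t in Set.Ici b, ‖deriv u t‖ₑ := by
  have h := HasCompactSupport.enorm_le_lintegral_Ici_deriv (f := fun t => u (-t))
    (hu.comp contDiff_neg) (h2u.comp_homeomorph (Homeomorph.neg ℝ)) (-b)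
  simp only [neg_neg] at h
  refine h.trans (le_of_eq ?_)
  simp_rw [deriv_comp_neg, enorm_neg]
  rw [← lintegral_indicator measurableSet_Iic, ← lintegral_indicator measurableSet_Ici,
    ← lintegral_neg_eq_self]
  congr 1
  ext t
  simp [Set.indicator]

theorem HasCompactSupport.mul_enorm_le_lintegral_mul_deriv {u : ℝ → ℝ} (hu : ContDiff ℝ 1 u)
    (h2u : HasCompactSupport u) {W : ℝ → ℝ≥0∞} (b : ℝ) (hW : ∀ t, |b| ≤ |t| → W b ≤ W t) :
    W b * ‖u b‖ₑ ≤ ∫⁻ t, W t * ‖deriv u t‖ₑ := by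
  have hm : Measurable fun t => ‖deriv u t‖ₑ := by fun_prop
  have key : ∀ s : Set ℝ, MeasurableSet s → (∀ t ∈ s, |b| ≤ |t|) →
      ‖u b‖ₑ ≤ ∫⁻ t in s, ‖deriv u t‖ₑ → W b * ‖u b‖ₑ ≤ ∫⁻ t, W t * ‖deriv u t‖ₑ := by
    intro s hs hbs hub
    calc W b * ‖u b‖ₑ ≤ W b * ∫⁻ t in s, ‖deriv u t‖ₑ := by gcongr
      _ = ∫⁻ t in s, W b * ‖deriv u t‖ₑ := (lintegral_const_mul _ hm).symm
      _ ≤ ∫⁻ t in s, W t * ‖deriv u t‖ₑ :=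
        setLIntegral_mono' hs fun t ht => by gcongr; exact hW t (hbs t ht)
      _ ≤ _ := setLIntegral_le_lintegral _ _
  rcases le_total 0 b with hb | hb
  · refine key (Set.Ici b) measurableSet_Ici (fun t ht => ?_)
      (h2u.enorm_le_setLIntegral_Ici_deriv hu b)
    exact abs_le_abs_of_nonneg hb ht
  · refine key (Set.Iic b) measurableSet_Iic (fun t ht => ?_)
      (HasCompactSupport.enorm_le_lintegral_Ici_deriv hu h2u b)
    exact abs_le_abs_of_nonpos hb ht

theorem lintegral_comp_smul_addHaar {E : Type*} [NormedAddCommGroup E] [NormedSpace ℝ E]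
    [MeasurableSpace E] [BorelSpace E] [FiniteDimensional ℝ E] (μ : Measure E)
    [μ.IsAddHaarMeasure] {g : E → ℝ≥0∞} (hg : Measurable g) {r : ℝ} (hr : 0 < r) :
    ∫⁻ x, g (r • x) ∂μ = ENNReal.ofReal (r ^ Module.finrank ℝ E)⁻¹ * ∫⁻ x, g x ∂μ := by
  rw [← lintegral_map hg (measurable_const_smul r), Measure.map_addHaar_smul μ hr.ne',
    lintegral_smul_measure, abs_of_pos (by positivity), smul_eq_mul]

theorem HasCompactSupport.comp_line {V : Type*} [NormedAddCommGroup V] [NormedSpace ℝ V]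
    {g : V → ℝ} (h2g : HasCompactSupport g) (p : V) {v : V} (hv : v ≠ 0) :
    HasCompactSupport fun t : ℝ => g (p + t • v) :=
  h2g.comp_isClosedEmbedding
    ((Homeomorph.addLeft p).isClosedEmbedding.comp (isClosedEmbedding_smul_left hv))

theorem ContDiff.comp_line {V : Type*} [NormedAddCommGroup V] [NormedSpace ℝ V]
    {g : V → ℝ} (hg : ContDiff ℝ 1 g) (p v : V) : ContDiff ℝ 1 fun t : ℝ => g (p + t • v) :=
  hg.comp (by fun_prop)

theorem deriv_comp_line {V : Type*} [NormedAddCommGroup V] [NormedSpace ℝ V]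
    {g : V → ℝ} (hg : Differentiable ℝ g) (p v : V) (t : ℝ) :
    deriv (fun t : ℝ => g (p + t • v)) t = fderiv ℝ g (p + t • v) v := by
  have h : HasDerivAt (fun t : ℝ => p + t • v) v t := by
    simpa using ((hasDerivAt_id t).smul_const v).const_add p
  exact ((hg _).hasFDerivAt.comp_hasDerivAt t h).deriv

section Grushin

variable {n m : ℕ} {α β : ℝ}
  {f : EuclideanSpace ℝ (Fin n) × EuclideanSpace ℝ (Fin m) → ℝ}

theorem fderiv_partial_left (hf : Differentiable ℝ f)
    (ξ : EuclideanSpace ℝ (Fin n) × EuclideanSpace ℝ (Fin m)) :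
    fderiv ℝ (fun x => f (x, ξ.2)) ξ.1 = (fderiv ℝ f ξ).comp (ContinuousLinearMap.inl ℝ _ _) :=
  ((hf ξ).hasFDerivAt.comp ξ.1 (hasFDerivAt_prodMk_left ξ.1 ξ.2)).fderiv

theorem fderiv_partial_right (hf : Differentiable ℝ f)
    (ξ : EuclideanSpace ℝ (Fin n) × EuclideanSpace ℝ (Fin m)) :
    fderiv ℝ (fun y => f (ξ.1, y)) ξ.2 = (fderiv ℝ f ξ).comp (ContinuousLinearMap.inr ℝ _ _) :=
  ((hf ξ).hasFDerivAt.comp ξ.2 (hasFDerivAt_prodMk_right ξ.1 ξ.2)).fderiv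

theorem norm_gradient_eq {E : Type*} [NormedAddCommGroup E] [InnerProductSpace ℝ E]
    [CompleteSpace E] (g : E → ℝ) (x : E) : ‖gradient g x‖ = ‖fderiv ℝ g x‖ := by
  simp [gradient]

theorem gradLNorm_eq (hf : Differentiable ℝ f)
    (ξ : EuclideanSpace ℝ (Fin n) × EuclideanSpace ℝ (Fin m)) :
    gradLNorm n m α β f ξ = √(‖ξ.1‖ ^ (2 * α) *
        ‖(fderiv ℝ f ξ).comp (ContinuousLinearMap.inl ℝ _ _)‖ ^ 2 + ‖ξ.1‖ ^ (2 * β) *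
        ‖(fderiv ℝ f ξ).comp (ContinuousLinearMap.inr ℝ _ _)‖ ^ 2) := by
  rw [gradLNorm, norm_gradient_eq, norm_gradient_eq, fderiv_partial_left hf,
    fderiv_partial_right hf]

theorem gradLNorm_nonneg (ξ : EuclideanSpace ℝ (Fin n) × EuclideanSpace ℝ (Fin m)) :
    0 ≤ gradLNorm n m α β f ξ := Real.sqrt_nonneg _

theorem continuous_gradLNorm (hα : 0 ≤ α) (hβ : 0 ≤ β) (hf : ContDiff ℝ 1 f) :
    Continuous (gradLNorm n m α β f) := by
  have h := hf.continuous_fderiv one_ne_zero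
  have h1 : Continuous fun ξ : EuclideanSpace ℝ (Fin n) × EuclideanSpace ℝ (Fin m) =>
      ‖ξ.1‖ ^ (2 * α) := continuous_fst.norm.rpow_const fun _ => Or.inr (by positivity)
  have h2 : Continuous fun ξ : EuclideanSpace ℝ (Fin n) × EuclideanSpace ℝ (Fin m) =>
      ‖ξ.1‖ ^ (2 * β) := continuous_fst.norm.rpow_const fun _ => Or.inr (by positivity)
  rw [funext (gradLNorm_eq (α := α) (β := β) (hf.differentiable one_ne_zero))]
  fun_prop

theorem hasCompactSupport_gradLNorm (hf : Differentiable ℝ f) (h2f : HasCompactSupport f) :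
    HasCompactSupport (gradLNorm n m α β f) := by
  refine (h2f.fderiv (𝕜 := ℝ)).mono fun ξ hξ => ?_
  contrapose! hξ
  rw [Function.notMem_support] at hξ ⊢
  simp [gradLNorm_eq hf, hξ]

theorem rpow_mul_norm_fderiv_inl_le (hf : Differentiable ℝ f)
    (ξ : EuclideanSpace ℝ (Fin n) × EuclideanSpace ℝ (Fin m)) :
    ‖ξ.1‖ ^ α * ‖(fderiv ℝ f ξ).comp (ContinuousLinearMap.inl ℝ _ _)‖ ≤ gradLNorm n m α β f ξ := by
  rw [gradLNorm_eq hf]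
  refine Real.le_sqrt_of_sq_le ?_
  rw [mul_pow, ← Real.rpow_mul_natCast (norm_nonneg _), mul_comm α]
  exact le_add_of_nonneg_right (by positivity)

theorem rpow_mul_norm_fderiv_inr_le (hf : Differentiable ℝ f)
    (ξ : EuclideanSpace ℝ (Fin n) × EuclideanSpace ℝ (Fin m)) :
    ‖ξ.1‖ ^ β * ‖(fderiv ℝ f ξ).comp (ContinuousLinearMap.inr ℝ _ _)‖ ≤ gradLNorm n m α β f ξ := by
  rw [gradLNorm_eq hf]
  refine Real.le_sqrt_of_sq_le ?_
  rw [mul_pow, ← Real.rpow_mul_natCast (norm_nonneg _), mul_comm β]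
  exact le_add_of_nonneg_left (by positivity)

theorem rpow_mul_abs_fderiv_left_le (hf : Differentiable ℝ f)
    (ξ : EuclideanSpace ℝ (Fin n) × EuclideanSpace ℝ (Fin m)) (v : EuclideanSpace ℝ (Fin n)) :
    ‖ξ.1‖ ^ α * |fderiv ℝ f ξ (v, 0)| ≤ gradLNorm n m α β f ξ * ‖v‖ := by
  have h := ((fderiv ℝ f ξ).comp (ContinuousLinearMap.inl ℝ _ _)).le_opNorm v
  have h2 := rpow_mul_norm_fderiv_inl_le (α := α) (β := β) hf ξ
  simp only [ContinuousLinearMap.comp_apply, ContinuousLinearMap.inl_apply, Real.norm_eq_abs] at h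
  calc _ ≤ ‖ξ.1‖ ^ α * (‖(fderiv ℝ f ξ).comp (ContinuousLinearMap.inl ℝ _ _)‖ * ‖v‖) := by gcongr
    _ ≤ _ := by rw [← mul_assoc]; gcongr

theorem rpow_mul_abs_fderiv_right_le (hf : Differentiable ℝ f)
    (ξ : EuclideanSpace ℝ (Fin n) × EuclideanSpace ℝ (Fin m)) (v : EuclideanSpace ℝ (Fin m)) :
    ‖ξ.1‖ ^ β * |fderiv ℝ f ξ (0, v)| ≤ gradLNorm n m α β f ξ * ‖v‖ := by
  have h := ((fderiv ℝ f ξ).comp (ContinuousLinearMap.inr ℝ _ _)).le_opNorm v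
  have h2 := rpow_mul_norm_fderiv_inr_le (α := α) (β := β) hf ξ
  simp only [ContinuousLinearMap.comp_apply, ContinuousLinearMap.inr_apply, Real.norm_eq_abs] at h
  calc _ ≤ ‖ξ.1‖ ^ β * (‖(fderiv ℝ f ξ).comp (ContinuousLinearMap.inr ℝ _ _)‖ * ‖v‖) := by gcongr
    _ ≤ _ := by rw [← mul_assoc]; gcongr

theorem rpow_mul_abs_le_setLIntegral_dilation (hf : ContDiff ℝ 1 f) (h2f : HasCompactSupport f)
    (hα : α < 1)
    (ξ : EuclideanSpace ℝ (Fin n) × EuclideanSpace ℝ (Fin m)) :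
    ENNReal.ofReal (‖ξ.1‖ ^ (α - 1) * |f ξ|) ≤
      ∫⁻ s in Set.Ioi (1 : ℝ), ENNReal.ofReal (s ^ (-α)) *
        ENNReal.ofReal (gradLNorm n m α β f (s • ξ.1, ξ.2)) := by
  rcases eq_or_ne ξ.1 0 with hx | hx
  · simp [hx, Real.zero_rpow (sub_neg.2 hα).ne]
  have hx' : 0 < ‖ξ.1‖ := norm_pos_iff.2 hx
  have hd := hf.differentiable one_ne_zero
  have hline : ∀ s : ℝ, ((0, ξ.2) + s • (ξ.1, 0) :
      EuclideanSpace ℝ (Fin n) × EuclideanSpace ℝ (Fin m)) = (s • ξ.1, ξ.2) := by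
    intro s; simp
  have h := (h2f.comp_line (0, ξ.2) (v := (ξ.1, 0))
    (by simpa using hx)).enorm_le_setLIntegral_Ici_deriv (hf.comp_line _ _) 1
  rw [one_smul, ← restrict_Ioi_eq_restrict_Ici] at h
  simp only [Prod.mk_add_mk, zero_add, add_zero, Prod.mk.eta] at h
  rw [ENNReal.ofReal_mul (by positivity), ← Real.enorm_eq_ofReal_abs]
  refine (mul_le_mul' le_rfl h).trans ?_
  rw [← lintegral_const_mul' _ _ ENNReal.ofReal_ne_top]
  refine setLIntegral_mono' measurableSet_Ioi fun s hs => ?_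
  have hs0 : (0 : ℝ) < s := zero_lt_one.trans hs
  rw [deriv_comp_line hd, hline, Real.enorm_eq_ofReal_abs, ← ENNReal.ofReal_mul (by positivity),
    ← ENNReal.ofReal_mul (by positivity)]
  apply ENNReal.ofReal_le_ofReal
  have h3 := rpow_mul_abs_fderiv_left_le (α := α) (β := β) hd (s • ξ.1, ξ.2) ξ.1
  rw [norm_smul, Real.norm_of_nonneg hs0.le, Real.mul_rpow hs0.le hx'.le] at h3
  rw [Real.rpow_sub_one hx'.ne', Real.rpow_neg hs0.le]
  have hsα : 0 < s ^ α := by positivity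
  calc _ = (s ^ α)⁻¹ * ‖ξ.1‖⁻¹ * (s ^ α * ‖ξ.1‖ ^ α * |fderiv ℝ f (s • ξ.1, ξ.2) (ξ.1, 0)|) := by
        field_simp
    _ ≤ (s ^ α)⁻¹ * ‖ξ.1‖⁻¹ * (gradLNorm n m α β f (s • ξ.1, ξ.2) * ‖ξ.1‖) := by gcongr
    _ = _ := by field_simp

theorem lintegral_comp_smul_fst {G : EuclideanSpace ℝ (Fin n) × EuclideanSpace ℝ (Fin m) → ℝ≥0∞}
    (hG : Measurable G) {s : ℝ} (hs : 0 < s) :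
    ∫⁻ ξ : EuclideanSpace ℝ (Fin n) × EuclideanSpace ℝ (Fin m), G (s • ξ.1, ξ.2) =
      ENNReal.ofReal (s ^ n)⁻¹ * ∫⁻ ξ, G ξ := by
  have hGs : Measurable fun ξ : EuclideanSpace ℝ (Fin n) × EuclideanSpace ℝ (Fin m) =>
      G (s • ξ.1, ξ.2) := hG.comp (by fun_prop)
  rw [Measure.volume_eq_prod, lintegral_prod_symm' _ hGs, lintegral_prod_symm' _ hG,
    ← lintegral_const_mul' _ _ ENNReal.ofReal_ne_top]
  refine lintegral_congr fun y => ?_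
  simpa using lintegral_comp_smul_addHaar volume (hG.comp (measurable_prodMk_right (y := y))) hs

theorem lintegral_setLIntegral_dilation
    {G : EuclideanSpace ℝ (Fin n) × EuclideanSpace ℝ (Fin m) → ℝ≥0∞} (hG : Measurable G) :
    ∫⁻ ξ : EuclideanSpace ℝ (Fin n) × EuclideanSpace ℝ (Fin m), ∫⁻ s in Set.Ioi (1 : ℝ),
      ENNReal.ofReal (s ^ (-α)) * G (s • ξ.1, ξ.2) =
    (∫⁻ s in Set.Ioi (1 : ℝ), ENNReal.ofReal (s ^ (-(α + n)))) * ∫⁻ ξ, G ξ := by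
  have hGm : Measurable fun p : (EuclideanSpace ℝ (Fin n) × EuclideanSpace ℝ (Fin m)) × ℝ =>
      ENNReal.ofReal (p.2 ^ (-α)) * G (p.2 • p.1.1, p.1.2) :=
    Measurable.mul (by fun_prop) (hG.comp (by fun_prop))
  rw [lintegral_lintegral_swap hGm.aemeasurable, ← lintegral_mul_const _ (by fun_prop)]
  refine setLIntegral_congr_fun measurableSet_Ioi fun s hs => ?_
  have hs0 : (0 : ℝ) < s := zero_lt_one.trans hs
  beta_reduce
  rw [lintegral_const_mul' _ _ ENNReal.ofReal_ne_top, lintegral_comp_smul_fst hG hs0, ← mul_assoc,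
    ← ENNReal.ofReal_mul (by positivity), neg_add, Real.rpow_add hs0,
    Real.rpow_neg hs0.le (n : ℝ), Real.rpow_natCast]

theorem lintegral_rpow_mul_abs_le (hα : α ∈ Set.Ioo (0 : ℝ) 1) (hβ : 0 ≤ β)
    (hf : ContDiff ℝ 1 f) (h2f : HasCompactSupport f) :
    ∫⁻ ξ, ENNReal.ofReal (‖ξ.1‖ ^ (α - 1) * |f ξ|) ≤
      (∫⁻ s in Set.Ioi (1 : ℝ), ENNReal.ofReal (s ^ (-(α + n)))) *
        ∫⁻ ξ, ENNReal.ofReal (gradLNorm n m α β f ξ) := by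
  rw [← lintegral_setLIntegral_dilation
    (continuous_gradLNorm hα.1.le hβ hf).measurable.ennreal_ofReal]
  exact lintegral_mono fun ξ => rpow_mul_abs_le_setLIntegral_dilation hf h2f hα.2 ξ

theorem setLIntegral_Ioi_rpow_ne_top (hn : 1 ≤ n) (hα : 0 < α) :
    ∫⁻ s in Set.Ioi (1 : ℝ), ENNReal.ofReal (s ^ (-(α + n))) ≠ ⊤ := by
  have hn' : (1 : ℝ) ≤ n := by exact_mod_cast hn
  exact (integrableOn_Ioi_rpow_of_lt (by linarith) zero_lt_one).lintegral_lt_top.ne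

theorem rpow_mul_abs_le_lintegral_line {γ : ℝ} (hγ : 0 ≤ γ) (hf : ContDiff ℝ 1 f)
    (h2f : HasCompactSupport f) (ξ : EuclideanSpace ℝ (Fin n) × EuclideanSpace ℝ (Fin m))
    {v : EuclideanSpace ℝ (Fin n) × EuclideanSpace ℝ (Fin m)} (hv : v ≠ 0) (b : ℝ)
    (hW : ∀ t, |b| ≤ |t| → ‖ξ.1‖ ≤ ‖(ξ + (t - b) • v).1‖)
    (hG : ∀ η, ‖η.1‖ ^ γ * |fderiv ℝ f η v| ≤ gradLNorm n m α β f η) :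
    ENNReal.ofReal (‖ξ.1‖ ^ γ * |f ξ|) ≤
      ∫⁻ t, ENNReal.ofReal (gradLNorm n m α β f (ξ + (t - b) • v)) := by
  have hp : ∀ t : ℝ, ξ - b • v + t • v = ξ + (t - b) • v := fun t => by module
  have h := (h2f.comp_line (ξ - b • v) hv).mul_enorm_le_lintegral_mul_deriv (hf.comp_line _ _)
    (W := fun t => ENNReal.ofReal (‖(ξ + (t - b) • v).1‖ ^ γ)) b fun t ht => by
      refine ENNReal.ofReal_le_ofReal (Real.rpow_le_rpow (norm_nonneg _) ?_ hγ)
      simpa using hW t ht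
  simp only [deriv_comp_line (hf.differentiable one_ne_zero)] at h
  simp only [hp, sub_self, zero_smul, add_zero, Real.enorm_eq_ofReal_abs] at h
  rw [ENNReal.ofReal_mul (by positivity)]
  refine h.trans (lintegral_mono fun t => ?_)
  rw [← ENNReal.ofReal_mul (by positivity)]
  exact ENNReal.ofReal_le_ofReal (hG _)

theorem norm_le_norm_add_smul_single (x : EuclideanSpace ℝ (Fin n)) (i : Fin n) {t : ℝ}
    (ht : |x i| ≤ |t|) : ‖x‖ ≤ ‖x + (t - x i) • EuclideanSpace.single i (1 : ℝ)‖ := by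
  rw [EuclideanSpace.norm_eq, EuclideanSpace.norm_eq]
  refine Real.sqrt_le_sqrt (Finset.sum_le_sum fun j _ => ?_)
  rcases eq_or_ne j i with rfl | hj
  · simpa using sq_le_sq.2 ht
  · simp [hj]

theorem rpow_mul_abs_le_lintegral_left (hα : 0 ≤ α) (hf : ContDiff ℝ 1 f)
    (h2f : HasCompactSupport f) (ξ : EuclideanSpace ℝ (Fin n) × EuclideanSpace ℝ (Fin m))
    (i : Fin n) :
    ENNReal.ofReal (‖ξ.1‖ ^ α * |f ξ|) ≤ ∫⁻ t, ENNReal.ofReal (gradLNorm n m α β f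
      (ξ + (t - ξ.1 i) • (EuclideanSpace.single i (1 : ℝ), 0))) := by
  refine rpow_mul_abs_le_lintegral_line hα hf h2f ξ (by simp) (ξ.1 i) (fun t ht => ?_) fun η => ?_
  · exact norm_le_norm_add_smul_single ξ.1 i ht
  · simpa using rpow_mul_abs_fderiv_left_le (α := α) (β := β) (hf.differentiable one_ne_zero) η
      (EuclideanSpace.single i (1 : ℝ))

theorem rpow_mul_abs_le_lintegral_right (hβ : 0 ≤ β) (hf : ContDiff ℝ 1 f)
    (h2f : HasCompactSupport f) (ξ : EuclideanSpace ℝ (Fin n) × EuclideanSpace ℝ (Fin m))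
    (j : Fin m) :
    ENNReal.ofReal (‖ξ.1‖ ^ β * |f ξ|) ≤ ∫⁻ t, ENNReal.ofReal (gradLNorm n m α β f
      (ξ + (t - ξ.2 j) • (0, EuclideanSpace.single j (1 : ℝ)))) := by
  refine rpow_mul_abs_le_lintegral_line hβ hf h2f ξ (by simp) (ξ.2 j) (fun t _ => ?_) fun η => ?_
  · simp
  · simpa using rpow_mul_abs_fderiv_right_le (α := α) (β := β) (hf.differentiable one_ne_zero) η
      (EuclideanSpace.single j (1 : ℝ))

/-- The coordinates `ℝⁿ⁺ᵐ → ℝⁿ × ℝᵐ`. -/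
def sumCoords (n m : ℕ) (z : Fin n ⊕ Fin m → ℝ) :
    EuclideanSpace ℝ (Fin n) × EuclideanSpace ℝ (Fin m) :=
  (WithLp.toLp 2 fun i => z (Sum.inl i), WithLp.toLp 2 fun j => z (Sum.inr j))

theorem measurePreserving_sumCoords : MeasurePreserving (sumCoords n m) :=
  ((PiLp.volume_preserving_toLp (Fin n)).prod (PiLp.volume_preserving_toLp (Fin m))).comp
    (volume_measurePreserving_sumPiEquivProdPi fun _ : Fin n ⊕ Fin m => ℝ)

theorem sumCoords_update_inl (z : Fin n ⊕ Fin m → ℝ) (i : Fin n) (t : ℝ) :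
    sumCoords n m (Function.update z (Sum.inl i) t) = sumCoords n m z +
      (t - (sumCoords n m z).1 i) • (EuclideanSpace.single i (1 : ℝ), 0) := by
  ext k
  · rcases eq_or_ne k i with rfl | hk
    · simp [sumCoords]
    · simp [sumCoords, hk]
  · simp [sumCoords]

theorem sumCoords_update_inr (z : Fin n ⊕ Fin m → ℝ) (j : Fin m) (t : ℝ) :
    sumCoords n m (Function.update z (Sum.inr j) t) = sumCoords n m z +
      (t - (sumCoords n m z).2 j) • (0, EuclideanSpace.single j (1 : ℝ)) := by
  ext k
  · simp [sumCoords]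
  · rcases eq_or_ne k j with rfl | hk
    · simp [sumCoords]
    · simp [sumCoords, hk]

theorem lintegral_rpow_mul_rpow_le (hn : 1 ≤ n) (hm : 1 ≤ m) (hα : 0 ≤ α) (hβ : 0 ≤ β)
    (hf : ContDiff ℝ 1 f) (h2f : HasCompactSupport f) :
    ∫⁻ ξ, ENNReal.ofReal (‖ξ.1‖ ^ α * |f ξ|) ^ ((n : ℝ) / (n + m - 1)) *
        ENNReal.ofReal (‖ξ.1‖ ^ β * |f ξ|) ^ ((m : ℝ) / (n + m - 1)) ≤
      (∫⁻ ξ, ENNReal.ofReal (gradLNorm n m α β f ξ)) ^ (((n : ℝ) + m) / (n + m - 1)) := by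
  have hn' : (1 : ℝ) ≤ n := by exact_mod_cast hn
  have hm' : (1 : ℝ) ≤ m := by exact_mod_cast hm
  have hG : Measurable fun ξ => ENNReal.ofReal (gradLNorm n m α β f ξ) :=
    (continuous_gradLNorm hα hβ hf).measurable.ennreal_ofReal
  have hc := hf.continuous
  have hcard : (Fintype.card (Fin n ⊕ Fin m) : ℝ) = n + m := by simp
  have hconj : Real.HolderConjugate (Fintype.card (Fin n ⊕ Fin m))
      (((n : ℝ) + m) / (n + m - 1)) := by
    rw [hcard]
    exact Real.HolderConjugate.conjExponent (by linarith)
  have key := lintegral_prod_lintegral_pow_le (fun _ : Fin n ⊕ Fin m => (volume : Measure ℝ)) hconj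
    (hG.comp measurePreserving_sumCoords.measurable)
  rw [← volume_pi] at key
  simp only [Function.comp_apply] at key
  rw [measurePreserving_sumCoords.lintegral_comp hG] at key
  rw [← measurePreserving_sumCoords.lintegral_comp (by fun_prop)]
  refine le_trans (lintegral_mono fun z => ?_) key
  simp only [hcard, Fintype.prod_sum_type, sumCoords_update_inl, sumCoords_update_inr]
  have h0 : (0 : ℝ) ≤ 1 / (n + m - 1) := by
    have : (0 : ℝ) < n + m - 1 := by linarith
    positivity
  refine mul_le_mul' ?_ ?_
  · calc _ = ∏ _i : Fin n, ENNReal.ofReal (‖(sumCoords n m z).1‖ ^ α * |f (sumCoords n m z)|) ^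
          ((1 : ℝ) / (n + m - 1)) := by
          rw [Finset.prod_const, Finset.card_univ, Fintype.card_fin, ← ENNReal.rpow_natCast,
            ← ENNReal.rpow_mul]
          ring_nf
      _ ≤ _ := by
        gcongr with i
        exact rpow_mul_abs_le_lintegral_left hα hf h2f _ i
  · calc _ = ∏ _i : Fin m, ENNReal.ofReal (‖(sumCoords n m z).1‖ ^ β * |f (sumCoords n m z)|) ^
          ((1 : ℝ) / (n + m - 1)) := by
          rw [Finset.prod_const, Finset.card_univ, Fintype.card_fin, ← ENNReal.rpow_natCast,
            ← ENNReal.rpow_mul]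
          ring_nf
      _ ≤ _ := by
        gcongr with i
        exact rpow_mul_abs_le_lintegral_right hβ hf h2f _ i

theorem add_lt_homDim (hn : 1 ≤ n) (hα : α ∈ Set.Ioo (0 : ℝ) 1) (hβ : 0 ≤ β) :
    (n + m : ℝ) < homDim n m α β := by
  have hn' : (1 : ℝ) ≤ n := by exact_mod_cast hn
  have h1 : 0 < 1 - α := sub_pos.2 hα.2
  rw [homDim, lt_div_iff₀ h1]
  have h2 : 0 ≤ (m : ℝ) * β := by positivity
  nlinarith [mul_pos (zero_lt_one.trans_le hn') hα.1]

theorem interpolation_pointwise {a c γ δ r s θ q : ℝ} (ha : 0 < a) (hc : 0 ≤ c)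
    (hr : 0 ≤ r) (hs : 0 ≤ s) (hrs : 0 < r + s) (hθ : 0 < θ) (hθ' : θ < 1)
    (hA : (γ * r + δ * s) * θ + (α - 1) * (1 - θ) = 0) (hC : (r + s) * θ + (1 - θ) = q) :
    ENNReal.ofReal c ^ q =
      (ENNReal.ofReal (a ^ γ * c) ^ r * ENNReal.ofReal (a ^ δ * c) ^ s) ^ θ *
        ENNReal.ofReal (a ^ (α - 1) * c) ^ (1 - θ) := by
  have h1 : 0 < 1 - θ := sub_pos.2 hθ'
  have hq : 0 < q := by rw [← hC]; positivity
  rw [ENNReal.ofReal_rpow_of_nonneg hc hq.le, ENNReal.ofReal_rpow_of_nonneg (by positivity) hr,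
    ENNReal.ofReal_rpow_of_nonneg (by positivity) hs, ← ENNReal.ofReal_mul (by positivity),
    ENNReal.ofReal_rpow_of_nonneg (by positivity) hθ.le,
    ENNReal.ofReal_rpow_of_nonneg (by positivity) h1.le, ← ENNReal.ofReal_mul (by positivity)]
  congr 1
  rcases hc.eq_or_lt with rfl | hc
  · simp [Real.zero_rpow hq.ne', Real.zero_rpow h1.ne']
  obtain ⟨A, rfl⟩ : ∃ A, Real.exp A = a := ⟨_, Real.exp_log ha⟩
  obtain ⟨C, rfl⟩ : ∃ C, Real.exp C = c := ⟨_, Real.exp_log hc⟩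
  simp only [← Real.exp_mul, ← Real.exp_add]
  congr 1
  linear_combination (-A) * hA - C * hC

theorem ae_fst_ne_zero (hn : 1 ≤ n) :
    ∀ᵐ ξ : EuclideanSpace ℝ (Fin n) × EuclideanSpace ℝ (Fin m), ξ.1 ≠ 0 := by
  have : Nonempty (Fin n) := ⟨⟨0, hn⟩⟩
  exact Measure.quasiMeasurePreserving_fst.ae (compl_mem_ae_iff.2 (measure_singleton 0))

theorem exists_lintegral_rpow_homDim_le (hn : 1 ≤ n) (hm : 1 ≤ m) (hα : α ∈ Set.Ioo (0 : ℝ) 1)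
    (hβ : 0 ≤ β) :
    ∃ K : ℝ≥0∞, K ≠ ⊤ ∧
      ∀ f : EuclideanSpace ℝ (Fin n) × EuclideanSpace ℝ (Fin m) → ℝ,
        ContDiff ℝ 1 f → HasCompactSupport f →
        ∫⁻ ξ, ENNReal.ofReal |f ξ| ^ (homDim n m α β / (homDim n m α β - 1)) ≤
          K * (∫⁻ ξ, ENNReal.ofReal (gradLNorm n m α β f ξ)) ^
            (homDim n m α β / (homDim n m α β - 1)) := by
  have hn' : (1 : ℝ) ≤ n := by exact_mod_cast hn
  have hm' : (1 : ℝ) ≤ m := by exact_mod_cast hm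
  have hα0 := hα.1
  have hα1 : 0 < 1 - α := sub_pos.2 hα.2
  have hN : (0 : ℝ) < n + m - 1 := by linarith
  have hαn : 0 < α * n := by positivity
  have hβm : 0 ≤ β * m := by positivity
  set w : ℝ := α * (n / (n + m - 1)) + β * (m / (n + m - 1)) with hw
  have hw0 : 0 < w := by positivity
  set θ : ℝ := (1 - α) / (w + (1 - α)) with hθ
  have hθ0 : 0 < θ := by positivity
  have hθ1 : θ < 1 := by rw [hθ, div_lt_one (by positivity)]; linarith
  have hθ1' : 0 < 1 - θ := sub_pos.2 hθ1
  set q : ℝ := homDim n m α β / (homDim n m α β - 1) with hq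
  have hA : w * θ + (α - 1) * (1 - θ) = 0 := by
    rw [hθ]; field_simp; ring
  have hC : (n / (n + m - 1) + m / (n + m - 1)) * θ + (1 - θ) = q := by
    have hQ := add_lt_homDim (m := m) hn hα hβ
    have hQ1 : (0 : ℝ) < n + m * (β + 1 - α) - (1 - α) := by nlinarith
    have hden : α * n + β * m + (n + m - 1) * (1 - α) = n + m * (β + 1 - α) - (1 - α) := by ring
    have hq' : q = (n + m * (β + 1 - α)) / (n + m * (β + 1 - α) - (1 - α)) := by
      rw [hq, homDim]; field_simp
    have hθ' : θ = (1 - α) * (n + m - 1) / (n + m * (β + 1 - α) - (1 - α)) := by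
      rw [hθ, hw, ← hden]; field_simp
    rw [hq', hθ']
    field_simp
    ring
  have hCr : (n + m : ℝ) / (n + m - 1) * θ + (1 - θ) = q := by rw [← hC, add_div]
  have hK := setLIntegral_Ioi_rpow_ne_top hn hα0
  refine ⟨(∫⁻ s in Set.Ioi (1 : ℝ), ENNReal.ofReal (s ^ (-(α + n)))) ^ (1 - θ),
    ENNReal.rpow_ne_top_of_nonneg hθ1'.le hK, fun f hf h2f => ?_⟩
  have hc := hf.continuous
  calc
    _ = ∫⁻ ξ, (ENNReal.ofReal (‖ξ.1‖ ^ α * |f ξ|) ^ ((n : ℝ) / (n + m - 1)) *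
        ENNReal.ofReal (‖ξ.1‖ ^ β * |f ξ|) ^ ((m : ℝ) / (n + m - 1))) ^ θ *
        ENNReal.ofReal (‖ξ.1‖ ^ (α - 1) * |f ξ|) ^ (1 - θ) := by
      refine lintegral_congr_ae ((ae_fst_ne_zero hn).mono fun ξ hξ => ?_)
      exact interpolation_pointwise (norm_pos_iff.2 hξ) (abs_nonneg _) (by positivity)
        (by positivity) (by positivity) hθ0 hθ1 hA hC
    _ ≤ _ := ENNReal.lintegral_mul_norm_pow_le (by fun_prop) (by fun_prop) hθ0.le hθ1'.le
        (by ring)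
    _ ≤ _ := mul_le_mul'
        (ENNReal.rpow_le_rpow (lintegral_rpow_mul_rpow_le hn hm hα0.le hβ hf h2f) hθ0.le)
        (ENNReal.rpow_le_rpow (lintegral_rpow_mul_abs_le hα hβ hf h2f) hθ1'.le)
    _ = _ := by
      rw [ENNReal.mul_rpow_of_nonneg _ _ hθ1'.le, ← ENNReal.rpow_mul, mul_left_comm,
        ← ENNReal.rpow_add_of_nonneg _ _ (by positivity) hθ1'.le, hCr]

theorem gradLNorm_norm_rpow_le (hf : Differentiable ℝ f) {γ : ℝ} (hγ : 1 < γ)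
    (ξ : EuclideanSpace ℝ (Fin n) × EuclideanSpace ℝ (Fin m)) :
    gradLNorm n m α β (fun ξ => ‖f ξ‖ ^ γ) ξ ≤ γ * ‖f ξ‖ ^ (γ - 1) * gradLNorm n m α β f ξ := by
  have hγ0 : 0 < γ := zero_lt_one.trans hγ
  have h1 := norm_fderiv_norm_rpow_le (f := fun x => f (x, ξ.2)) (by fun_prop) (x := ξ.1) hγ
  have h2 := norm_fderiv_norm_rpow_le (f := fun y => f (ξ.1, y)) (by fun_prop) (x := ξ.2) hγ
  simp only [Prod.mk.eta] at h1 h2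
  simp only [gradLNorm, norm_gradient_eq]
  refine Real.sqrt_le_iff.2 ⟨by positivity, ?_⟩
  rw [mul_pow, Real.sq_sqrt (by positivity)]
  calc _ ≤ ‖ξ.1‖ ^ (2 * α) * (γ * ‖f ξ‖ ^ (γ - 1) * ‖fderiv ℝ (fun x => f (x, ξ.2)) ξ.1‖) ^ 2 +
        ‖ξ.1‖ ^ (2 * β) * (γ * ‖f ξ‖ ^ (γ - 1) * ‖fderiv ℝ (fun y => f (ξ.1, y)) ξ.2‖) ^ 2 := by
        gcongr
    _ = _ := by ring

theorem HasCompactSupport.integrable_rpow_abs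
    {g : EuclideanSpace ℝ (Fin n) × EuclideanSpace ℝ (Fin m) → ℝ}
    (h2g : HasCompactSupport g) (hg : Continuous g) {r : ℝ} (hr : 0 < r) :
    Integrable fun ξ => |g ξ| ^ r :=
  (hg.abs.rpow_const fun _ => Or.inr hr.le).integrable_of_hasCompactSupport
    (h2g.comp_left (g := fun t => |t| ^ r) (by simp [hr.ne']))

theorem ofReal_integral_rpow_abs {g : EuclideanSpace ℝ (Fin n) × EuclideanSpace ℝ (Fin m) → ℝ}
    (h2g : HasCompactSupport g) (hg : Continuous g) {r : ℝ} (hr : 0 < r) :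
    ENNReal.ofReal (∫ ξ, |g ξ| ^ r) = ∫⁻ ξ, ENNReal.ofReal |g ξ| ^ r := by
  rw [ofReal_integral_eq_lintegral_ofReal (h2g.integrable_rpow_abs hg hr)
    (Filter.Eventually.of_forall fun _ => by positivity)]
  simp_rw [ENNReal.ofReal_rpow_of_nonneg (abs_nonneg _) hr.le]

theorem lintegral_gradLNorm_norm_rpow_le (hα : 0 ≤ α) (hβ : 0 ≤ β) (hf : ContDiff ℝ 1 f)
    {p r γ : ℝ} (hp : 1 < p) (hγ : 1 < γ) (hr : (γ - 1) = r * (1 - 1 / p)) :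
    ∫⁻ ξ, ENNReal.ofReal (gradLNorm n m α β (fun ξ => ‖f ξ‖ ^ γ) ξ) ≤
      ENNReal.ofReal γ * ((∫⁻ ξ, ENNReal.ofReal |f ξ| ^ r) ^ (1 - 1 / p) *
        (∫⁻ ξ, ENNReal.ofReal (gradLNorm n m α β f ξ) ^ p) ^ (1 / p)) := by
  have hp0 : 0 < p := zero_lt_one.trans hp
  have hp1 : 0 ≤ 1 - 1 / p := by rw [sub_nonneg, div_le_one hp0]; exact hp.le
  have hγ0 : 0 < γ := zero_lt_one.trans hγ
  have hc := hf.continuous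
  have hG := continuous_gradLNorm hα hβ hf
  calc _ ≤ ∫⁻ ξ, ENNReal.ofReal γ * ((ENNReal.ofReal |f ξ| ^ r) ^ (1 - 1 / p) *
        (ENNReal.ofReal (gradLNorm n m α β f ξ) ^ p) ^ (1 / p)) := by
        refine lintegral_mono fun ξ => ?_
        rw [← ENNReal.rpow_mul, ← hr, ← ENNReal.rpow_mul, mul_one_div_cancel hp0.ne',
          ENNReal.rpow_one, ENNReal.ofReal_rpow_of_nonneg (abs_nonneg _) (sub_nonneg.2 hγ.le),
          ← ENNReal.ofReal_mul (by positivity), ← ENNReal.ofReal_mul hγ0.le, ← mul_assoc]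
        exact ENNReal.ofReal_le_ofReal
          (gradLNorm_norm_rpow_le (hf.differentiable one_ne_zero) hγ ξ)
    _ ≤ _ := by
        rw [lintegral_const_mul' _ _ ENNReal.ofReal_ne_top]
        exact mul_le_mul' le_rfl (ENNReal.lintegral_mul_norm_pow_le (by fun_prop) (by fun_prop) hp1
          (by positivity) (by ring))

theorem ENNReal.rpow_le_of_le_mul_rpow {A B K g : ℝ≥0∞} {p q e : ℝ} (hp : 1 < p) (hq : 0 < q)
    (he : 0 < e) (hpq : p / q = (p - 1) + e) (hA : A ≠ ⊤)
    (h : A ≤ K * (g * (A ^ (1 - 1 / p) * B ^ (1 / p))) ^ q) :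
    A ^ e ≤ K ^ (p / q) * g ^ p * B := by
  have hp0 : 0 < p := zero_lt_one.trans hp
  have hpq0 : 0 < p / q := div_pos hp0 hq
  rcases eq_or_ne A 0 with rfl | hA0
  · simp [ENNReal.zero_rpow_of_pos he]
  have h1 := ENNReal.rpow_le_rpow h hpq0.le
  have e1 : q * (p / q) = p := by field_simp
  have e2 : (1 - 1 / p) * p = p - 1 := by field_simp
  rw [ENNReal.mul_rpow_of_nonneg _ _ hpq0.le, ← ENNReal.rpow_mul, e1,
    ENNReal.mul_rpow_of_nonneg _ _ hp0.le, ENNReal.mul_rpow_of_nonneg _ _ hp0.le,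
    ← ENNReal.rpow_mul, ← ENNReal.rpow_mul, e2, one_div_mul_cancel hp0.ne', ENNReal.rpow_one,
    hpq, ENNReal.rpow_add _ _ hA0 hA, ← hpq] at h1
  have h2 : A ^ (p - 1) * A ^ e ≤ A ^ (p - 1) * (K ^ (p / q) * g ^ p * B) := by
    refine h1.trans (le_of_eq ?_)
    ring
  exact (ENNReal.mul_le_mul_iff_right (ENNReal.rpow_pos (pos_iff_ne_zero.2 hA0) hA).ne'
    (ENNReal.rpow_ne_top_of_nonneg (sub_pos.2 hp).le hA)).1 h2

theorem exists_lintegral_sobolev (hn : 1 ≤ n) (hm : 1 ≤ m) (hα : α ∈ Set.Ioo (0 : ℝ) 1)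
    (hβ : 0 ≤ β) {p : ℝ} (hp : 1 ≤ p) (hpQ : p < homDim n m α β) :
    ∃ K : ℝ≥0∞, K ≠ ⊤ ∧
      ∀ f : EuclideanSpace ℝ (Fin n) × EuclideanSpace ℝ (Fin m) → ℝ,
        ContDiff ℝ 1 f → HasCompactSupport f →
        (∫⁻ ξ, ENNReal.ofReal |f ξ| ^ (homDim n m α β * p / (homDim n m α β - p))) ^
            ((homDim n m α β - p) / homDim n m α β) ≤
          K * ∫⁻ ξ, ENNReal.ofReal (gradLNorm n m α β f ξ) ^ p := by
  obtain ⟨K, hK, hsob⟩ := exists_lintegral_rpow_homDim_le (m := m) hn hm hα hβ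
  set Q := homDim n m α β
  have hQ1 : 0 < Q - 1 := by linarith
  have hQ0 : 0 < Q := by linarith
  have hQp : 0 < Q - p := sub_pos.2 hpQ
  rcases hp.eq_or_lt with rfl | hp1
  · have he : 0 < (Q - 1) / Q := by positivity
    refine ⟨K ^ ((Q - 1) / Q), ENNReal.rpow_ne_top_of_nonneg he.le hK, fun f hf h2f => ?_⟩
    have h := ENNReal.rpow_le_rpow (hsob f hf h2f) he.le
    rw [ENNReal.mul_rpow_of_nonneg _ _ he.le, ← ENNReal.rpow_mul,
      show Q / (Q - 1) * ((Q - 1) / Q) = 1 by field_simp, ENNReal.rpow_one] at h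
    simpa using h
  · have hγ1 : 1 < p * (Q - 1) / (Q - p) := by
      rw [lt_div_iff₀ hQp]
      nlinarith
    have hr : 0 < Q * p / (Q - p) := by positivity
    refine ⟨K ^ (p / (Q / (Q - 1))) * ENNReal.ofReal (p * (Q - 1) / (Q - p)) ^ p,
      ENNReal.mul_ne_top (ENNReal.rpow_ne_top_of_nonneg (by positivity) hK)
        (ENNReal.rpow_ne_top_of_nonneg (by positivity) ENNReal.ofReal_ne_top), fun f hf h2f => ?_⟩
    refine ENNReal.rpow_le_of_le_mul_rpow hp1 (by positivity) (by positivity)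
      (by field_simp; ring) ?_ ?_
    · rw [← ofReal_integral_rpow_abs h2f hf.continuous hr]
      exact ENNReal.ofReal_ne_top
    · calc _ = ∫⁻ ξ, ENNReal.ofReal |‖f ξ‖ ^ (p * (Q - 1) / (Q - p))| ^ (Q / (Q - 1)) := by
            refine lintegral_congr fun ξ => ?_
            rw [Real.norm_eq_abs, abs_of_nonneg (Real.rpow_nonneg (abs_nonneg (f ξ)) _),
              ← ENNReal.ofReal_rpow_of_nonneg (abs_nonneg _) (by positivity), ← ENNReal.rpow_mul]
            congr 1
            field_simp
        _ ≤ _ := hsob _ (hf.norm_rpow hγ1) (h2f.comp_left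
            (g := fun t : ℝ => ‖t‖ ^ (p * (Q - 1) / (Q - p)))
            (by simp [(zero_lt_one.trans hγ1).ne']))
        _ ≤ _ := by
            gcongr
            exact lintegral_gradLNorm_norm_rpow_le hα.1.le hβ hf hp1 hγ1 (by field_simp; ring)

end Grushin

/-- The Sobolev inequalities `(S_Q^p)` for all `1 ≤ p < Q`. -/
theorem sobolev_ineq_Sp (n m : ℕ) (hn : 1 ≤ n) (hm : 1 ≤ m) (α β : ℝ)
    (hα : α ∈ Set.Ioo (0 : ℝ) 1) (hβ : 0 ≤ β) :
    ∀ p : ℝ, 1 ≤ p → p < homDim n m α β →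
      ∃ C : ℝ, 0 < C ∧
        ∀ f : EuclideanSpace ℝ (Fin n) × EuclideanSpace ℝ (Fin m) → ℝ,
          ContDiff ℝ (⊤ : ℕ∞) f → HasCompactSupport f →
          (∫ ξ, |f ξ| ^ (homDim n m α β * p / (homDim n m α β - p))) ^
              ((homDim n m α β - p) / homDim n m α β)
            ≤ C * ∫ ξ, gradLNorm n m α β f ξ ^ p := by
  intro p hp hpQ
  obtain ⟨K, hK, hsob⟩ := exists_lintegral_sobolev hn hm hα hβ hp hpQ
  refine ⟨K.toReal + 1, by positivity, fun f hf h2f => ?_⟩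
  have hf1 : ContDiff ℝ 1 f := hf.of_le (by exact_mod_cast le_top)
  have h := hsob f hf1 h2f
  have hp0 : 0 < p := zero_lt_one.trans_le hp
  have hQ0 : 0 < homDim n m α β := hp0.trans hpQ
  have hQp : 0 < homDim n m α β - p := sub_pos.2 hpQ
  have hG := ofReal_integral_rpow_abs (hasCompactSupport_gradLNorm (α := α) (β := β)
    (hf1.differentiable one_ne_zero) h2f) (continuous_gradLNorm hα.1.le hβ hf1) hp0
  simp only [abs_of_nonneg (gradLNorm_nonneg _)] at hG
  have hI : 0 ≤ ∫ ξ, gradLNorm n m α β f ξ ^ p :=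
    integral_nonneg fun ξ => Real.rpow_nonneg (gradLNorm_nonneg ξ) p
  rw [← ofReal_integral_rpow_abs h2f hf1.continuous (by positivity), ← hG,
    ENNReal.ofReal_rpow_of_nonneg (by positivity) (by positivity), ← ENNReal.ofReal_toReal hK,
    ← ENNReal.ofReal_mul ENNReal.toReal_nonneg,
    ENNReal.ofReal_le_ofReal_iff (by positivity)] at h
  exact h.trans (by gcongr; linarith)
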